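/- Let H = (V, E) be a finite hypergraph. The collection of all quarks of H (over all parameters k) is a laminar family: if S is a k-quark and T is a k'-quark for natural numbers k, k', then S ∩ T = ∅, or S ⊆ T, or T ⊆ S. -/

import Mathlib

variable {V : Type*}

/-- Degree of node `v` in the hypergraph with hyperedge set `E` induced on `S`:
the number of hyperedges contained in `S` that contain `v`. -/
def hdeg [DecidableEq V] (E : Finset (Finset V)) (S : Finset V) (v : V) : ℕ :=
  (E.filter fun e => v ∈ e ∧ e ⊆ S).card

/-- Nodes `u` and `v` are connected in the hypergraph induced on `S`:
there is a nonempty sequence of hyperedges of `H|_S` starting at an edge containing `u`,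
ending at an edge containing `v`, with consecutive edges intersecting. -/
def HConn [DecidableEq V] (E : Finset (Finset V)) (S : Finset V) (u v : V) : Prop :=
  ∃ (l : List (Finset V)) (hl : l ≠ []),
    (∀ e ∈ l, e ∈ E ∧ e ⊆ S) ∧ u ∈ l.head hl ∧ v ∈ l.getLast hl ∧
    l.Chain' fun e f => (e ∩ f).Nonempty

/-- The hypergraph induced on `S` is connected. -/
def ConnectedOn [DecidableEq V] (E : Finset (Finset V)) (S : Finset V) : Prop :=
  ∀ u ∈ S, ∀ v ∈ S, HConn E S u v

/-- `S` is a `k`-quark: the induced hypergraph is connected, has minimum degree at least `k`,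
and `S` is maximal with these two properties. -/
def IsQuark [DecidableEq V] (E : Finset (Finset V)) (k : ℕ) (S : Finset V) : Prop :=
  ConnectedOn E S ∧ (∀ v ∈ S, k ≤ hdeg E S v) ∧
    ∀ T : Finset V, S ⊆ T → ConnectedOn E T → (∀ v ∈ T, k ≤ hdeg E T v) → T = S

/-- The quark number of `u`: the largest `k` such that `u` belongs to a nonempty `k`-quark. -/
noncomputable def quarkNum [DecidableEq V] (E : Finset (Finset V)) (u : V) : ℕ :=
  sSup {k : ℕ | ∃ S : Finset V, IsQuark E k S ∧ u ∈ S}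

theorem hdeg_mono [DecidableEq V] (E : Finset (Finset V)) {S T : Finset V} (h : S ⊆ T) (v : V) :
    hdeg E S v ≤ hdeg E T v :=
  Finset.card_le_card <| Finset.monotone_filter_right E fun _ _ he => ⟨he.1, he.2.trans h⟩

theorem HConn.mono [DecidableEq V] {E : Finset (Finset V)} {S T : Finset V} (h : S ⊆ T) {u v : V}
    (huv : HConn E S u v) : HConn E T u v := by
  obtain ⟨l, hl, hE, hu, hv, hc⟩ := huv
  exact ⟨l, hl, fun e he => ⟨(hE e he).1, (hE e he).2.trans h⟩, hu, hv, hc⟩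

theorem HConn.trans [DecidableEq V] {E : Finset (Finset V)} {S : Finset V} {u v w : V}
    (huv : HConn E S u v) (hvw : HConn E S v w) : HConn E S u w := by
  obtain ⟨l, hl, hE, hu, hv, hc⟩ := huv
  obtain ⟨m, hm, hE', hv', hw, hc'⟩ := hvw
  refine ⟨l ++ m, by simp [hl], fun e he => (List.mem_append.1 he).elim (hE e) (hE' e),
    by rwa [List.head_append_of_ne_nil hl], by rwa [List.getLast_append_of_ne_nil _ hm],
    List.isChain_append.2 ⟨hc, hc', fun x hx y hy => ?_⟩⟩
  rw [List.getLast?_eq_some_getLast hl, Option.mem_some] at hx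
  rw [List.head?_eq_some_head hm, Option.mem_some] at hy
  subst hx hy
  exact ⟨v, Finset.mem_inter.2 ⟨hv, hv'⟩⟩

theorem ConnectedOn.union [DecidableEq V] {E : Finset (Finset V)} {S T : Finset V}
    (hS : ConnectedOn E S) (hT : ConnectedOn E T) (h : (S ∩ T).Nonempty) :
    ConnectedOn E (S ∪ T) := by
  obtain ⟨w, hw⟩ := h
  obtain ⟨hwS, hwT⟩ := Finset.mem_inter.1 hw
  intro u hu v hv
  have huw : HConn E (S ∪ T) u w := (Finset.mem_union.1 hu).elim
    (fun hu => (hS u hu w hwS).mono Finset.subset_union_left)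
    (fun hu => (hT u hu w hwT).mono Finset.subset_union_right)
  have hwv : HConn E (S ∪ T) w v := (Finset.mem_union.1 hv).elim
    (fun hv => (hS w hwS v hv).mono Finset.subset_union_left)
    (fun hv => (hT w hwT v hv).mono Finset.subset_union_right)
  exact huw.trans hwv

theorem IsQuark.subset_of_le [DecidableEq V] {E : Finset (Finset V)} {k k' : ℕ} {S T : Finset V}
    (hS : IsQuark E k S) (hT : IsQuark E k' T) (h : (S ∩ T).Nonempty) (hk : k ≤ k') : T ⊆ S := by
  refine Finset.union_eq_left.1 <|
    hS.2.2 (S ∪ T) Finset.subset_union_left (hS.1.union hT.1 h) fun v hv => ?_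
  rcases Finset.mem_union.1 hv with hv | hv
  · exact (hS.2.1 v hv).trans (hdeg_mono E Finset.subset_union_left v)
  · exact (hk.trans (hT.2.1 v hv)).trans (hdeg_mono E Finset.subset_union_right v)

/-- the collection of all quarks (over all parameters) is a laminar family. -/
theorem stmt_6 [Fintype V] [DecidableEq V] (E : Finset (Finset V)) (k k' : ℕ)
    (S T : Finset V) (hS : IsQuark E k S) (hT : IsQuark E k' T) :
    S ∩ T = ∅ ∨ S ⊆ T ∨ T ⊆ S := by
  rcases (S ∩ T).eq_empty_or_nonempty with h | h
  · exact Or.inl h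
  rcases le_total k k' with hk | hk
  · exact Or.inr (Or.inr (hS.subset_of_le hT h hk))
  · exact Or.inr (Or.inl (hT.subset_of_le hS (Finset.inter_comm S T ▸ h) hk))
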